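/- arXiv:1401.3388 — 4 statements merged into one kernel-verified Lean document; each statement's English description precedes it below -/
import Mathlib

section
/- The flow M(θ) preserves the elliptic quadratic form 2|x|² + |ξ|² − x·ξ: for all θ ∈ ℝ and all (x₀, ξ₀) ∈ ℝ^n × ℝ^n, writing (x(θ), ξ(θ)) = M(θ)(x₀, ξ₀), one has 2|x(θ)|² + |ξ(θ)|² − x(θ)·ξ(θ) = 2|x₀|² + |ξ₀|² − x₀·ξ₀. -/
open MeasureTheory Real SchwartzMap
open scoped InnerProductSpace ComplexConjugate

noncomputable section

/-- `ℝ^n` as a Euclidean space. -/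
abbrev En (n : ℕ) := EuclideanSpace ℝ (Fin n)

/-- The linear flow `M(θ)` on `ℝ^n × ℝ^n` (with `k = √7`). -/
def Mflow (n : ℕ) (θ : ℝ) (z : En n × En n) : En n × En n :=
  ((Real.cos (Real.sqrt 7 * θ) - (Real.sqrt 7)⁻¹ * Real.sin (Real.sqrt 7 * θ)) • z.1
     + (2 * (Real.sqrt 7)⁻¹ * Real.sin (Real.sqrt 7 * θ)) • z.2,
   (-(4 * (Real.sqrt 7)⁻¹ * Real.sin (Real.sqrt 7 * θ))) • z.1
     + (Real.cos (Real.sqrt 7 * θ) + (Real.sqrt 7)⁻¹ * Real.sin (Real.sqrt 7 * θ)) • z.2)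

/-- The special parameter value `θ₀ = (1/√7)·arccos(3/4)`. -/
def θ₀ : ℝ := (Real.sqrt 7)⁻¹ * Real.arccos (3 / 4)

/-- The Fourier transform `φ̂(p) = (2π)^{-n/2} ∫ e^{-i p·y} φ(y) dy`. -/
def FT (n : ℕ) (φ : En n → ℂ) (p : En n) : ℂ :=
  (((2 * Real.pi) ^ (-(n : ℝ) / 2) : ℝ) : ℂ) *
    ∫ y : En n, Complex.exp (-(Complex.I * (⟪p, y⟫_ℝ : ℂ))) * φ y

/-- Partial Fourier transform in the second variable. -/
def F2 (n : ℕ) (Ψ : En n × En n → ℂ) (z : En n × En n) : ℂ :=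
  (((2 * Real.pi) ^ (-(n : ℝ) / 2) : ℝ) : ℂ) *
    ∫ p : En n, Complex.exp (-(Complex.I * (⟪z.2, p⟫_ℝ : ℂ))) * Ψ (z.1, p)

/-- Inverse partial Fourier transform in the second variable. -/
def F2inv (n : ℕ) (Ψ : En n × En n → ℂ) (z : En n × En n) : ℂ :=
  (((2 * Real.pi) ^ (-(n : ℝ) / 2) : ℝ) : ℂ) *
    ∫ ξ : En n, Complex.exp (Complex.I * (⟪ξ, z.2⟫_ℝ : ℂ)) * Ψ (z.1, ξ)

/-- The operator `U(θ) = F₂⁻¹ ∘ T(θ) ∘ F₂`, where `T(θ)Φ = Φ ∘ M(-θ)`. -/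
def Uop (n : ℕ) (θ : ℝ) (Ψ : En n × En n → ℂ) : En n × En n → ℂ :=
  F2inv n (fun z => F2 n Ψ (Mflow n (-θ) z))

/-- The cross Wigner function. -/
def Wig (n : ℕ) (ψ φ : En n → ℂ) (z : En n × En n) : ℂ :=
  (((2 * Real.pi) ^ (-(n : ℝ)) : ℝ) : ℂ) *
    ∫ ξ : En n, Complex.exp (Complex.I * (⟪z.2, ξ⟫_ℝ : ℂ)) *
      ψ (z.1 - (2⁻¹ : ℝ) • ξ) * conj (φ (z.1 + (2⁻¹ : ℝ) • ξ))

/-- The fractional cross Wigner function `W^θ(ψ,φ) = (2π)^{-n/2} U(θ)(ψ ⊗ conj φ̂)`. -/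
def fWig (n : ℕ) (θ : ℝ) (ψ φ : En n → ℂ) (z : En n × En n) : ℂ :=
  (((2 * Real.pi) ^ (-(n : ℝ) / 2) : ℝ) : ℂ) *
    Uop n θ (fun w => ψ w.1 * conj (FT n φ w.2)) z

/-- Inverse Fourier transform of a kernel in its second variable. -/
def GK (n : ℕ) (K : En n × En n → ℂ) (z : En n × En n) : ℂ :=
  (((2 * Real.pi) ^ (-(n : ℝ) / 2) : ℝ) : ℂ) *
    ∫ y : En n, Complex.exp (Complex.I * (⟪z.2, y⟫_ℝ : ℂ)) * K (z.1, y)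

/-- The Weyl pseudo-differential operator with symbol `a`. -/
def OpW (n : ℕ) (a : En n × En n → ℂ) (ψ : En n → ℂ) (x : En n) : ℂ :=
  (((2 * Real.pi) ^ (-(n : ℝ)) : ℝ) : ℂ) *
    ∫ w : En n × En n, Complex.exp (Complex.I * (⟪x - w.1, w.2⟫_ℝ : ℂ)) *
      a ((2⁻¹ : ℝ) • (x + w.1), w.2) * ψ w.1

/-- The phase-space extension `Â` of the Weyl operator with symbol `a`. -/
def hatA (n : ℕ) (a : En n × En n → ℂ) (Ψ : En n × En n → ℂ) (z : En n × En n) : ℂ :=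
  (((2 * Real.pi) ^ (-(n : ℝ)) : ℝ) : ℂ) *
    ∫ w : En n × En n, Complex.exp (Complex.I * (⟪z.1 - w.1, w.2⟫_ℝ : ℂ)) *
      a ((2⁻¹ : ℝ) • (z.1 + w.1), w.2) * Ψ (w.1, z.2)

/-- The flow `M(θ)` preserves the elliptic quadratic form
`2|x|² + |ξ|² − x·ξ`. -/
theorem statement3 (n : ℕ) (θ : ℝ) (x₀ ξ₀ : En n) :
    2 * ‖(Mflow n θ (x₀, ξ₀)).1‖ ^ 2 + ‖(Mflow n θ (x₀, ξ₀)).2‖ ^ 2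
        - ⟪(Mflow n θ (x₀, ξ₀)).1, (Mflow n θ (x₀, ξ₀)).2⟫_ℝ
      = 2 * ‖x₀‖ ^ 2 + ‖ξ₀‖ ^ 2 - ⟪x₀, ξ₀⟫_ℝ := by
  have hcs : Real.cos (√7 * θ) ^ 2 + 7 * ((√7)⁻¹ * Real.sin (√7 * θ)) ^ 2 = 1 := by
    have h7 : (√7 : ℝ) ^ 2 = 7 := Real.sq_sqrt (by norm_num)
    rw [mul_pow, inv_pow, h7, mul_inv_cancel_left₀ (by norm_num), Real.cos_sq_add_sin_sq]
  simp only [Mflow, mul_assoc, ← real_inner_self_eq_norm_sq, inner_add_left, inner_add_right,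
    real_inner_smul_left, real_inner_smul_right, real_inner_comm x₀ ξ₀]
  linear_combination (2 * ⟪x₀, x₀⟫_ℝ + ⟪ξ₀, ξ₀⟫_ℝ - ⟪x₀, ξ₀⟫_ℝ) * hcs
end
end

section
/- Metaplectic formulation of the Wigner transform: for all Schwartz functions ψ, φ on ℝ^n and all (x,p) ∈ ℝ^n × ℝ^n, U(θ₀)(ψ ⊗ conj φ̂)(x,p) = (2π)^{n/2} W(ψ,φ)(x,p), where W(ψ,φ)(x,p) = (2π)^{−n} ∫_{ℝ^n} e^{i p·ξ} ψ(x − ξ/2) conj(φ(x + ξ/2)) dξ is the cross Wigner function. -/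
open MeasureTheory Real SchwartzMap
open scoped InnerProductSpace ComplexConjugate

noncomputable section

/-- The rescaled transform `FT` in terms of Mathlib's Fourier transform. -/
lemma FT_eq_fourier (n : ℕ) (φ : En n → ℂ) (p : En n) :
    FT n φ p = (((2 * Real.pi) ^ (-(n : ℝ) / 2) : ℝ) : ℂ) *
      FourierTransform.fourier φ ((2 * Real.pi)⁻¹ • p) := by
  have hπ : (Real.pi : ℂ) ≠ 0 := by exact_mod_cast Real.pi_ne_zero
  rw [FT, Real.fourier_eq']
  congr 2 with y
  rw [smul_eq_mul, real_inner_smul_right, real_inner_comm]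
  congr 2
  push_cast
  field_simp

/-- Fourier inversion for `FT` on Schwartz functions. -/
lemma FT_inversion (n : ℕ) (φ : SchwartzMap (En n) ℂ) (ξ : En n) :
    (((2 * Real.pi) ^ (-(n : ℝ) / 2) : ℝ) : ℂ) *
      ∫ p : En n, Complex.exp (Complex.I * (⟪ξ, p⟫_ℝ : ℂ)) * FT n φ p = φ ξ := by
  have hπ : (Real.pi : ℂ) ≠ 0 := by exact_mod_cast Real.pi_ne_zero
  have h2π : (0 : ℝ) < 2 * Real.pi := by positivity
  have hinv : FourierTransformInv.fourierInv (FourierTransform.fourier (φ : En n → ℂ)) ξ = φ ξ := by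
    rw [← SchwartzMap.fourier_coe, ← SchwartzMap.fourierInv_coe,
      FourierTransform.fourierInv_fourier_eq]
  have key : ∫ p : En n, Complex.exp (Complex.I * (⟪ξ, p⟫_ℝ : ℂ)) *
      FourierTransform.fourier (φ : En n → ℂ) ((2 * Real.pi)⁻¹ • p)
      = (((2 * Real.pi) ^ n : ℝ) : ℂ) * φ ξ := by
    rw [← hinv, Real.fourierInv_eq']
    have := Measure.integral_comp_inv_smul_of_nonneg (volume : Measure (En n))
      (fun q : En n => Complex.exp (((2 * Real.pi * ⟪q, ξ⟫_ℝ : ℝ) : ℂ) * Complex.I) •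
        FourierTransform.fourier (φ : En n → ℂ) q) h2π.le
    rw [finrank_euclideanSpace_fin] at this
    rw [← Complex.real_smul, ← this]
    congr 1 with p
    rw [smul_eq_mul, real_inner_smul_left, real_inner_comm]
    congr 2
    push_cast
    field_simp
  simp_rw [FT_eq_fourier, mul_left_comm _ (((2 * Real.pi) ^ (-(n : ℝ) / 2) : ℝ) : ℂ)]
  rw [integral_const_mul, key, ← mul_assoc, ← mul_assoc, ← Complex.ofReal_mul,
    ← Complex.ofReal_mul, ← Real.rpow_natCast, ← Real.rpow_add h2π, ← Real.rpow_add h2π]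
  ring_nf
  simp

/-- The partial Fourier transform of `ψ ⊗ conj φ̂` is `ψ ⊗ conj φ`. -/
lemma F2_tensor_conj_FT (n : ℕ) (ψ : En n → ℂ) (φ : SchwartzMap (En n) ℂ) (z : En n × En n) :
    F2 n (fun w => ψ w.1 * conj (FT n φ w.2)) z = ψ z.1 * conj (φ z.2) := by
  rw [F2, ← FT_inversion n φ z.2, map_mul, Complex.conj_ofReal, ← integral_conj]
  simp_rw [mul_left_comm _ (ψ z.1)]
  rw [integral_const_mul, mul_left_comm]
  congr 3 with p
  rw [map_mul, ← Complex.exp_conj, map_mul, Complex.conj_I, Complex.conj_ofReal, neg_mul]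

/-- At `-θ₀` the flow is `(x, ξ) ↦ (x - ξ/2, x + ξ/2)`. -/
lemma Mflow_neg_θ₀ (n : ℕ) (x ξ : En n) :
    Mflow n (-θ₀) (x, ξ) = (x - (2⁻¹ : ℝ) • ξ, x + (2⁻¹ : ℝ) • ξ) := by
  have h7 : Real.sqrt 7 ≠ 0 := by positivity
  have hθ : Real.sqrt 7 * θ₀ = Real.arccos (3 / 4) := by rw [θ₀, mul_inv_cancel_left₀ h7]
  have hcos : Real.cos (Real.sqrt 7 * -θ₀) = 3 / 4 := by
    rw [mul_neg, Real.cos_neg, hθ, Real.cos_arccos (by norm_num) (by norm_num)]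
  have hsin : (Real.sqrt 7)⁻¹ * Real.sin (Real.sqrt 7 * -θ₀) = -(1 / 4) := by
    rw [mul_neg, Real.sin_neg, hθ, Real.sin_arccos,
      show (1 - (3 / 4) ^ 2 : ℝ) = 7 / 4 ^ 2 by norm_num, Real.sqrt_div (by norm_num),
      Real.sqrt_sq (by norm_num)]
    field_simp
  simp only [Mflow, mul_assoc, hcos, hsin]
  exact Prod.ext (by dsimp only; module) (by dsimp only; module)

/-- Metaplectic formulation of the Wigner transform:
`U(θ₀)(ψ ⊗ conj φ̂) = (2π)^{n/2} W(ψ,φ)`. -/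
theorem statement6 (n : ℕ) (ψ φ : SchwartzMap (En n) ℂ) (x p : En n) :
    Uop n θ₀ (fun w => ψ w.1 * conj (FT n (⇑φ) w.2)) (x, p)
      = (((2 * Real.pi) ^ ((n : ℝ) / 2) : ℝ) : ℂ) * Wig n (⇑ψ) (⇑φ) (x, p) := by
  simp only [Uop, F2inv, Wig, F2_tensor_conj_FT, Mflow_neg_θ₀]
  rw [← mul_assoc, ← Complex.ofReal_mul, ← Real.rpow_add (by positivity)]
  congr 2
  · ring_nf
  · ext ξ
    rw [real_inner_comm, mul_assoc]
end
end

section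
/- Regularity of the fractional Wigner transform: for every θ ∈ ℝ and all Schwartz functions ψ, φ on ℝ^n, the fractional cross Wigner function W^θ(ψ,φ) is a Schwartz function on ℝ^n × ℝ^n. -/
open MeasureTheory Real SchwartzMap
open scoped InnerProductSpace ComplexConjugate

noncomputable section

open scoped FourierTransform ContDiff

namespace SchwartzMap

section Tensor

variable {E F : Type*} [NormedAddCommGroup E] [NormedSpace ℝ E]
  [NormedAddCommGroup F] [NormedSpace ℝ F]

theorem norm_iteratedFDeriv_comp_clm_le {D V : Type*} [NormedAddCommGroup D] [NormedSpace ℝ D]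
    [NormedAddCommGroup V] [NormedSpace ℝ V] (f : 𝓢(E, V)) (L : D →L[ℝ] E) (hL : ‖L‖ ≤ 1)
    (i : ℕ) (z : D) :
    ‖iteratedFDeriv ℝ i (fun w => f (L w)) z‖ ≤ ‖iteratedFDeriv ℝ i f (L z)‖ := by
  have h := L.iteratedFDeriv_comp_right (f.smooth i) z (i := i) le_rfl
  change iteratedFDeriv ℝ i (fun w => f (L w)) z = _ at h
  rw [h]
  refine (ContinuousMultilinearMap.norm_compContinuousLinearMap_le _ _).trans ?_
  simpa using mul_le_of_le_one_right (norm_nonneg (iteratedFDeriv ℝ i f (L z)))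
    (pow_le_one₀ (norm_nonneg L) hL)

/-- The tensor product `(x, y) ↦ f x * g y` of two Schwartz functions. -/
def tensor (f : 𝓢(E, ℂ)) (g : 𝓢(F, ℂ)) : 𝓢(E × F, ℂ) where
  toFun z := f z.1 * g z.2
  smooth' := ((f.smooth ⊤).comp contDiff_fst).mul ((g.smooth ⊤).comp contDiff_snd)
  decay' k n := by
    refine ⟨∑ i ∈ Finset.range (n + 1), (n.choose i : ℝ) *
      (SchwartzMap.seminorm ℝ k i f * SchwartzMap.seminorm ℝ 0 (n - i) g +
        SchwartzMap.seminorm ℝ 0 i f * SchwartzMap.seminorm ℝ k (n - i) g), fun z => ?_⟩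
    have hmul := norm_iteratedFDeriv_mul_le (N := n) (n := n)
      ((f.smooth n).comp (contDiff_fst (E := E) (F := F)))
      ((g.smooth n).comp (contDiff_snd (E := E) (F := F))) z le_rfl
    refine (mul_le_mul_of_nonneg_left hmul (by positivity)).trans ?_
    rw [Finset.mul_sum]
    refine Finset.sum_le_sum fun i _ => ?_
    have hf := f.norm_iteratedFDeriv_comp_clm_le (.fst ℝ E F)
      (ContinuousLinearMap.norm_fst_le ..) i z
    have hg := g.norm_iteratedFDeriv_comp_clm_le (.snd ℝ E F)
      (ContinuousLinearMap.norm_snd_le ..) (n - i) z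
    have hz : ‖z‖ ^ k ≤ ‖z.1‖ ^ k + ‖z.2‖ ^ k := by
      rcases max_choice ‖z.1‖ ‖z.2‖ with h | h <;> rw [Prod.norm_def, h] <;> simp
    have hf0 := f.norm_iteratedFDeriv_le_seminorm ℝ i z.1
    have hg0 := g.norm_iteratedFDeriv_le_seminorm ℝ (n - i) z.2
    have hfk := f.le_seminorm ℝ k i z.1
    have hgk := g.le_seminorm ℝ k (n - i) z.2
    calc ‖z‖ ^ k * ((n.choose i : ℝ) * ‖iteratedFDeriv ℝ i (f ∘ Prod.fst) z‖ *
            ‖iteratedFDeriv ℝ (n - i) (g ∘ Prod.snd) z‖)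
        ≤ (‖z.1‖ ^ k + ‖z.2‖ ^ k) * ((n.choose i : ℝ) * ‖iteratedFDeriv ℝ i f z.1‖ *
            ‖iteratedFDeriv ℝ (n - i) g z.2‖) := by gcongr <;> assumption
      _ = (n.choose i : ℝ) *
          ((‖z.1‖ ^ k * ‖iteratedFDeriv ℝ i f z.1‖) * ‖iteratedFDeriv ℝ (n - i) g z.2‖ +
            ‖iteratedFDeriv ℝ i f z.1‖ * (‖z.2‖ ^ k * ‖iteratedFDeriv ℝ (n - i) g z.2‖)) := by
          ring
      _ ≤ _ := by gcongr

@[simp]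
theorem tensor_apply (f : 𝓢(E, ℂ)) (g : 𝓢(F, ℂ)) (z : E × F) :
    tensor f g z = f z.1 * g z.2 := rfl

end Tensor

section PartialFourier

universe u

variable {E F V : Type u} [NormedAddCommGroup E] [NormedSpace ℝ E]
  [NormedAddCommGroup F] [InnerProductSpace ℝ F]
  [NormedAddCommGroup V] [NormedSpace ℂ V]

theorem hasTemperateGrowth_prodMk (x : E) :
    (fun ξ : F => (x, ξ)).HasTemperateGrowth := by
  have h : (fun ξ : F => (x, ξ)) = (fun _ => ((x, 0) : E × F)) + ⇑(ContinuousLinearMap.inr ℝ E F) := by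
    ext ξ <;> simp
  rw [h]
  exact (Function.HasTemperateGrowth.const _).add (ContinuousLinearMap.hasTemperateGrowth _)

theorem antilipschitz_prodMk {E F : Type*} [SeminormedAddCommGroup E] [SeminormedAddCommGroup F]
    (x : E) : AntilipschitzWith 1 (fun ξ : F => (x, ξ)) :=
  AntilipschitzWith.of_le_mul_dist fun a b => by simp [Prod.dist_eq]

/-- The restriction `ξ ↦ f (x, ξ)` of a Schwartz function to a slice. -/
def slice (f : 𝓢(E × F, V)) (x : E) : 𝓢(F, V) :=
  compCLMOfAntilipschitz ℝ (hasTemperateGrowth_prodMk x) (antilipschitz_prodMk x) f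

@[simp]
theorem slice_apply (f : 𝓢(E × F, V)) (x : E) (ξ : F) : slice f x ξ = f (x, ξ) := rfl

/-- The Schwartz function whose partial Fourier transform is the derivative of the partial
Fourier transform of `f`. -/
def partialFourierDeriv (f : 𝓢(E × F, V)) : 𝓢(E × F, E × F →L[ℝ] V) :=
  postcompCLM ((ContinuousLinearMap.compL ℝ (E × F) (E × F) V).flip
      ((ContinuousLinearMap.inl ℝ E F).comp (.fst ℝ E F))) (fderivCLM ℝ (E × F) V f) -
    (2 * π * Complex.I) • smulRightCLM ℂ V
      ((innerSL ℝ : F →L[ℝ] F →L[ℝ] ℝ).bilinearComp (.snd ℝ E F) (.snd ℝ E F)) f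

theorem partialFourierDeriv_apply (f : 𝓢(E × F, V)) (z w : E × F) :
    partialFourierDeriv f z w =
      fderiv ℝ f z (w.1, 0) - (2 * π * Complex.I) • ⟪z.2, w.2⟫_ℝ • f z := rfl

/-- The derivative of `f` in the second variable. -/
def sndDeriv (f : 𝓢(E × F, V)) : 𝓢(E × F, F →L[ℝ] V) :=
  postcompCLM ((ContinuousLinearMap.compL ℝ F (E × F) V).flip (.inr ℝ E F))
    (fderivCLM ℝ (E × F) V f)

theorem slice_sndDeriv (f : 𝓢(E × F, V)) (x : E) :
    slice (sndDeriv f) x = fderivCLM ℝ F V (slice f x) := by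
  ext1 ξ
  have h := (f.hasFDerivAt (x, ξ)).comp ξ (hasFDerivAt_prodMk_right (𝕜 := ℝ) x ξ)
  exact h.fderiv.symm

/-- A weight that dominates every Schwartz function on `E × F`, uniformly in the first variable. -/
def sndWeight (F : Type u) [NormedAddCommGroup F] [InnerProductSpace ℝ F] (ξ : F) : ℝ :=
  (1 + ‖ξ‖) ^ (-((Module.finrank ℝ F + 1 : ℕ) : ℝ))

theorem exists_norm_le_sndWeight (f : 𝓢(E × F, V)) (k : ℕ) :
    ∃ C : ℝ, ∀ x ξ, ‖x‖ ^ k * ‖f (x, ξ)‖ ≤ C * sndWeight F ξ := by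
  set m := Module.finrank ℝ F + 1
  refine ⟨2 ^ (k + m) * (Finset.Iic (k + m, 0)).sup
    (fun m => SchwartzMap.seminorm ℝ m.1 m.2) f, fun x ξ => ?_⟩
  have h := one_add_le_sup_seminorm_apply (𝕜 := ℝ) (m := (k + m, 0)) le_rfl le_rfl f (x, ξ)
  rw [norm_iteratedFDeriv_zero] at h
  have hx : ‖x‖ ≤ 1 + ‖(x, ξ)‖ := (le_max_left ‖x‖ ‖ξ‖).trans (by simp [Prod.norm_def])
  have hξ : 1 + ‖ξ‖ ≤ 1 + ‖(x, ξ)‖ := by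
    gcongr; exact le_max_right ‖x‖ ‖ξ‖
  have hpos : 0 < 1 + ‖ξ‖ := by positivity
  rw [sndWeight, Real.rpow_neg hpos.le, Real.rpow_natCast, ← div_eq_mul_inv,
    le_div_iff₀ (by positivity)]
  refine le_trans ?_ h
  calc ‖x‖ ^ k * ‖f (x, ξ)‖ * (1 + ‖ξ‖) ^ m
      ≤ (1 + ‖(x, ξ)‖) ^ k * ‖f (x, ξ)‖ * (1 + ‖(x, ξ)‖) ^ m := by gcongr
    _ = _ := by rw [pow_add]; ring

theorem hasFDerivAt_partialFourier_integrand (f : 𝓢(E × F, V)) (z : E × F) (ξ : F) :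
    HasFDerivAt (fun z : E × F =>
        Complex.exp ((↑(-2 * π * ⟪ξ, z.2⟫_ℝ) * Complex.I)) • f (z.1, ξ))
      (Complex.exp ((↑(-2 * π * ⟪ξ, z.2⟫_ℝ) * Complex.I)) • partialFourierDeriv f (z.1, ξ)) z := by
  have hin : HasFDerivAt (fun z : E × F => -2 * π * ⟪ξ, z.2⟫_ℝ)
      ((-2 * π) • (innerSL ℝ ξ).comp (.snd ℝ E F)) z :=
    ((innerSL ℝ ξ).comp (.snd ℝ E F)).hasFDerivAt.const_mul (-2 * π)
  have hphase := ((Complex.ofRealCLM.hasFDerivAt.comp z hin).mul_const Complex.I).cexp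
  have hf : HasFDerivAt (fun z : E × F => f (z.1, ξ))
      ((fderiv ℝ f (z.1, ξ)).comp ((ContinuousLinearMap.inl ℝ E F).comp (.fst ℝ E F))) z := by
    have := (hasFDerivAt_prodMk_left (𝕜 := ℝ) z.1 ξ).comp z
      (ContinuousLinearMap.fst ℝ E F).hasFDerivAt
    exact (f.hasFDerivAt (z.1, ξ)).comp z this
  refine (hphase.smul hf).congr_fderiv ?_
  refine ContinuousLinearMap.ext fun w => ?_
  rw [_root_.smul_apply, partialFourierDeriv_apply]
  simp only [sub_eq_add_neg, ← Complex.coe_smul]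
  simp [smul_smul]
  rw [← Complex.coe_smul, smul_smul]
  ring_nf

variable [FiniteDimensional ℝ F] [MeasurableSpace F] [BorelSpace F]

theorem integrable_sndWeight : Integrable (sndWeight F) :=
  integrable_one_add_norm (by push_cast; linarith)

/-- The Fourier transform of `f` in the second variable. -/
def partialFourierFun (f : 𝓢(E × F, V)) (z : E × F) : V := 𝓕 (slice f z.1) z.2

theorem partialFourierFun_eq (f : 𝓢(E × F, V)) (z : E × F) :
    partialFourierFun f z =
      ∫ ξ : F, Complex.exp ((↑(-2 * π * ⟪ξ, z.2⟫_ℝ) * Complex.I)) • f (z.1, ξ) := by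
  rw [partialFourierFun, fourier_coe, fourier_eq']
  rfl

theorem exists_pow_mul_norm_partialFourierFun_le (f : 𝓢(E × F, V)) (k : ℕ) :
    ∃ C : ℝ, ∀ z : E × F, ‖z.1‖ ^ k * ‖partialFourierFun f z‖ ≤ C := by
  obtain ⟨C, hC⟩ := exists_norm_le_sndWeight f k
  refine ⟨∫ ξ, C * sndWeight F ξ, fun z => ?_⟩
  have h : ‖partialFourierFun f z‖ ≤ ∫ ξ, ‖slice f z.1 ξ‖ :=
    VectorFourier.norm_fourierIntegral_le_integral_norm _ _ _ _ _
  calc ‖z.1‖ ^ k * ‖partialFourierFun f z‖ ≤ ‖z.1‖ ^ k * ∫ ξ, ‖slice f z.1 ξ‖ := by gcongr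
    _ = ∫ ξ, ‖z.1‖ ^ k * ‖slice f z.1 ξ‖ := (integral_const_mul _ _).symm
    _ ≤ _ := integral_mono ((slice f z.1).integrable.norm.const_mul _)
        (integrable_sndWeight.const_mul _) fun ξ => hC z.1 ξ

theorem norm_mul_norm_partialFourierFun_le (f : 𝓢(E × F, V)) (z : E × F) :
    ‖z.2‖ * ‖partialFourierFun f z‖ ≤ ‖partialFourierFun (sndDeriv f) z‖ := by
  have h : partialFourierFun (sndDeriv f) z =
      (2 * π * Complex.I) • (innerSL ℝ z.2).smulRight (partialFourierFun f z) := by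
    rw [partialFourierFun, slice_sndDeriv, fourier_fderivCLM_eq]
    rfl
  have hc : (1 : ℝ) ≤ ‖(2 * π * Complex.I : ℂ)‖ := by
    simp only [norm_mul, Complex.norm_ofNat, Complex.norm_real, Complex.norm_I, mul_one,
      Real.norm_of_nonneg pi_pos.le]
    linarith [pi_gt_three]
  rw [h, norm_smul, ContinuousLinearMap.norm_smulRight_apply, innerSL_apply_norm]
  exact le_mul_of_one_le_left (by positivity) hc

theorem exists_pow_mul_pow_mul_norm_partialFourierFun_le (l k : ℕ) (f : 𝓢(E × F, V)) :
    ∃ C : ℝ, ∀ z : E × F, ‖z.2‖ ^ l * (‖z.1‖ ^ k * ‖partialFourierFun f z‖) ≤ C := by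
  induction l generalizing V with
  | zero => simpa using exists_pow_mul_norm_partialFourierFun_le f k
  | succ l ih =>
    obtain ⟨C, hC⟩ := ih (sndDeriv f)
    refine ⟨C, fun z => le_trans ?_ (hC z)⟩
    calc ‖z.2‖ ^ (l + 1) * (‖z.1‖ ^ k * ‖partialFourierFun f z‖)
        = ‖z.2‖ ^ l * (‖z.1‖ ^ k * (‖z.2‖ * ‖partialFourierFun f z‖)) := by ring
      _ ≤ _ := by gcongr; exact norm_mul_norm_partialFourierFun_le f z

theorem hasFDerivAt_partialFourierFun (f : 𝓢(E × F, V)) (z : E × F) :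
    HasFDerivAt (partialFourierFun f)
      (partialFourierFun (V := E × F →L[ℝ] V) (partialFourierDeriv f) z) z := by
  obtain ⟨C, hC⟩ := exists_norm_le_sndWeight (V := E × F →L[ℝ] V) (partialFourierDeriv f) 0
  rw [funext (partialFourierFun_eq f), partialFourierFun_eq]
  have hcont {W : Type u} [NormedAddCommGroup W] [NormedSpace ℂ W] (g : 𝓢(E × F, W)) (z : E × F) :
      AEStronglyMeasurable (fun ξ : F =>
        Complex.exp ((↑(-2 * π * ⟪ξ, z.2⟫_ℝ) * Complex.I)) • g (z.1, ξ)) := by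
    have := (slice g z.1).continuous
    exact Continuous.aestronglyMeasurable (.smul (by fun_prop) this)
  have hnorm (ξ p : F) : ‖Complex.exp ((↑(-2 * π * ⟪ξ, p⟫_ℝ) * Complex.I))‖ = 1 :=
    Complex.norm_exp_ofReal_mul_I _
  refine hasFDerivAt_integral_of_dominated_of_fderiv_le Filter.univ_mem
    (.of_forall (hcont f)) ?_ (hcont _ z) (bound := fun ξ => C * sndWeight F ξ) ?_
    (integrable_sndWeight.const_mul C)
    (.of_forall fun ξ z _ => hasFDerivAt_partialFourier_integrand f z ξ)
  · refine (slice f z.1).integrable.mono (hcont f z) (.of_forall fun ξ => ?_)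
    rw [norm_smul, hnorm, one_mul, slice_apply]
  · refine .of_forall fun ξ z _ => ?_
    rw [norm_smul, hnorm, one_mul]
    simpa using hC z.1 ξ

theorem fderiv_partialFourierFun (f : 𝓢(E × F, V)) :
    fderiv ℝ (partialFourierFun f) =
      partialFourierFun (V := E × F →L[ℝ] V) (partialFourierDeriv f) :=
  funext fun z => (hasFDerivAt_partialFourierFun f z).fderiv

theorem contDiff_partialFourierFun (n : ℕ) (f : 𝓢(E × F, V)) :
    ContDiff ℝ n (partialFourierFun f) := by
  induction n generalizing V with
  | zero =>
    exact contDiff_zero.2 (continuous_iff_continuousAt.2 fun z =>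
      (hasFDerivAt_partialFourierFun f z).continuousAt)
  | succ n ih =>
    have h := ih (V := E × F →L[ℝ] V) (partialFourierDeriv f)
    rw [← fderiv_partialFourierFun] at h
    push_cast
    exact contDiff_succ_iff_fderiv.2
      ⟨fun z => (hasFDerivAt_partialFourierFun f z).differentiableAt, by simp, h⟩

theorem partialFourierFun_decay (k n : ℕ) (f : 𝓢(E × F, V)) :
    ∃ C : ℝ, ∀ z, ‖z‖ ^ k * ‖iteratedFDeriv ℝ n (partialFourierFun f) z‖ ≤ C := by
  induction n generalizing V with
  | zero =>
    obtain ⟨C₁, h₁⟩ := exists_pow_mul_pow_mul_norm_partialFourierFun_le 0 k f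
    obtain ⟨C₂, h₂⟩ := exists_pow_mul_pow_mul_norm_partialFourierFun_le k 0 f
    refine ⟨max C₁ C₂, fun z => ?_⟩
    rw [norm_iteratedFDeriv_zero]
    rcases max_choice ‖z.1‖ ‖z.2‖ with h | h <;> rw [Prod.norm_def, h]
    · exact le_max_of_le_left (by simpa using h₁ z)
    · exact le_max_of_le_right (by simpa using h₂ z)
  | succ n ih =>
    obtain ⟨C, hC⟩ := ih (V := E × F →L[ℝ] V) (partialFourierDeriv f)
    refine ⟨C, fun z => ?_⟩
    rw [← norm_iteratedFDeriv_fderiv, fderiv_partialFourierFun]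
    exact hC z

/-- The Fourier transform in the second variable, as a Schwartz function. -/
def partialFourier (f : 𝓢(E × F, V)) : 𝓢(E × F, V) where
  toFun := partialFourierFun f
  smooth' := contDiff_infty.2 fun n => contDiff_partialFourierFun n f
  decay' k n := partialFourierFun_decay k n f

theorem partialFourier_apply (f : 𝓢(E × F, V)) (z : E × F) :
    partialFourier f z =
      ∫ ξ : F, Complex.exp ((↑(-2 * π * ⟪ξ, z.2⟫_ℝ) * Complex.I)) • f (z.1, ξ) :=
  partialFourierFun_eq f z

end PartialFourier

end SchwartzMap

theorem exists_continuousLinearEquiv_of_det_eq_one (E : Type*) [NormedAddCommGroup E]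
    [NormedSpace ℝ E] {a b c d : ℝ} (h : a * d - b * c = 1) :
    ∃ e : (E × E) ≃L[ℝ] (E × E), ∀ z, e z = (a • z.1 + b • z.2, c • z.1 + d • z.2) := by
  let block (a b c d : ℝ) : (E × E) →L[ℝ] (E × E) :=
    (a • ContinuousLinearMap.fst ℝ E E + b • ContinuousLinearMap.snd ℝ E E).prod
      (c • ContinuousLinearMap.fst ℝ E E + d • ContinuousLinearMap.snd ℝ E E)
  refine ⟨.equivOfInverse (block a b c d) (block d (-b) (-c) a) (fun z => ?_) (fun z => ?_),
    fun z => rfl⟩ <;>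
    refine Prod.ext ?_ ?_ <;>
    simp only [block, ContinuousLinearMap.prod_apply, _root_.add_apply,
      _root_.smul_apply, ContinuousLinearMap.coe_fst',
      ContinuousLinearMap.coe_snd'] <;>
    match_scalars <;> first | ring1 | linear_combination h

theorem exists_continuousLinearEquiv_eq_Mflow (n : ℕ) (θ : ℝ) :
    ∃ e : (En n × En n) ≃L[ℝ] (En n × En n), ∀ z, e z = Mflow n θ z := by
  refine exists_continuousLinearEquiv_of_det_eq_one (En n) ?_
  have h7 : (√7)⁻¹ ^ 2 = (7 : ℝ)⁻¹ := by rw [inv_pow, Real.sq_sqrt (by norm_num)]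
  linear_combination Real.sin_sq_add_cos_sq (√7 * θ) + 7 * Real.sin (√7 * θ) ^ 2 * h7

theorem exists_schwartzMap_eq_FT (n : ℕ) (φ : 𝓢(En n, ℂ)) :
    ∃ G : 𝓢(En n, ℂ), ∀ p, G p = FT n φ p := by
  let e : En n ≃L[ℝ] En n := .smulLeft (Units.mk0 (2 * π)⁻¹ (by positivity))
  refine ⟨(((2 * π) ^ (-(n : ℝ) / 2) : ℝ) : ℂ) • compCLMOfContinuousLinearEquiv ℂ e (𝓕 φ),
    fun p => ?_⟩
  change _ * (𝓕 φ) ((2 * π)⁻¹ • p) = _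
  rw [FT, fourier_coe, fourier_eq']
  congr 2 with y
  rw [smul_eq_mul, real_inner_smul_right, real_inner_comm]
  congr 2
  push_cast
  field_simp

theorem exists_schwartzMap_eq_F2 (n : ℕ) (ψ φ : 𝓢(En n, ℂ)) :
    ∃ T : 𝓢(En n × En n, ℂ), ∀ z, T z = F2 n (fun w => ψ w.1 * conj (FT n φ w.2)) z := by
  obtain ⟨G, hG⟩ := exists_schwartzMap_eq_FT n φ
  let G' : 𝓢(En n, ℂ) := postcompCLM (Complex.conjCLE : ℂ →L[ℝ] ℂ) G
  obtain ⟨H, hH⟩ := exists_schwartzMap_eq_FT n G'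
  refine ⟨tensor ψ H, fun z => ?_⟩
  have hG' (p : En n) : G' p = conj (FT n φ p) := by rw [← hG]; rfl
  simp only [tensor_apply, hH, FT, F2, hG', mul_left_comm _ (ψ z.1)]
  rw [integral_const_mul, mul_left_comm]

/-- Regularity: for Schwartz `ψ, φ`, the fractional cross Wigner
function `W^θ(ψ,φ)` is a Schwartz function on `ℝ^n × ℝ^n`. -/
theorem statement10 (n : ℕ) (θ : ℝ) (ψ φ : SchwartzMap (En n) ℂ) :
    ∃ W : SchwartzMap (En n × En n) ℂ, ∀ z : En n × En n, W z = fWig n θ (⇑ψ) (⇑φ) z := by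
  obtain ⟨T, hT⟩ := exists_schwartzMap_eq_F2 n ψ φ
  obtain ⟨e, he⟩ := exists_continuousLinearEquiv_eq_Mflow n (-θ)
  let s : En n ≃L[ℝ] En n := .smulLeft (Units.mk0 (-(2 * π)⁻¹) (neg_ne_zero.2 (by positivity)))
  let c : ℂ := (((2 * π) ^ (-(n : ℝ) / 2) : ℝ) : ℂ)
  refine ⟨c • c • compCLMOfContinuousLinearEquiv ℂ ((ContinuousLinearEquiv.refl ℝ (En n)).prodCongr s)
    (partialFourier (compCLMOfContinuousLinearEquiv ℂ e T)), fun z => ?_⟩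
  change c * (c * partialFourier (compCLMOfContinuousLinearEquiv ℂ e T)
    (z.1, (-(2 * π)⁻¹) • z.2)) = c * (c * _)
  rw [partialFourier_apply]
  congr 3 with ξ
  rw [compCLMOfContinuousLinearEquiv_apply, Function.comp_apply, he, hT, smul_eq_mul,
    real_inner_smul_right]
  congr 2
  push_cast
  field_simp
end
end

section
/- Fractional kernel formula: let K be a Schwartz function on ℝ^n × ℝ^n, let K†(x,y) = conj(K(y,x)) be the adjoint kernel, let θ ∈ ℝ, and let b^θ = (2π)^{n/2} U(θ)(G K†), where (G K†)(x,p) = (2π)^{−n/2} ∫ e^{i p·y} K†(x,y) dy. Then for all Schwartz ψ, φ on ℝ^n, ∫∫_{ℝ^n×ℝ^n} K(x,y) ψ(y) conj(φ(x)) dy dx = ∫∫_{ℝ^n×ℝ^n} conj(b^θ(x,p)) · W^θ(ψ,φ)(x,p) dx dp. -/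
open MeasureTheory Real SchwartzMap
open scoped InnerProductSpace ComplexConjugate

noncomputable section

open scoped FourierTransform

/-- The tensor product of two Schwartz functions is smooth with rapidly decaying derivatives. -/
def schwartzTensor {E F : Type*} [NormedAddCommGroup E] [NormedSpace ℝ E]
    [NormedAddCommGroup F] [NormedSpace ℝ F] (f : 𝓢(E, ℂ)) (g : 𝓢(F, ℂ)) : 𝓢(E × F, ℂ) where
  toFun z := f z.1 * g z.2
  smooth' := ((f.smooth ⊤).comp contDiff_fst).mul ((g.smooth ⊤).comp contDiff_snd)
  decay' := by
    intro k m
    choose C hCpos hC using fun i j => f.decay i j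
    choose D hDpos hD using fun i j => g.decay i j
    have hf (i : ℕ) (z : E × F) :
        ‖iteratedFDeriv ℝ i (fun z : E × F => f z.1) z‖ ≤ ‖iteratedFDeriv ℝ i f z.1‖ := by
      have h := (ContinuousLinearMap.fst ℝ E F).iteratedFDeriv_comp_right
        (f.smooth ⊤) z (i := i) (mod_cast le_top)
      change iteratedFDeriv ℝ i (fun z : E × F => f z.1) z = _ at h
      rw [h]
      refine (ContinuousMultilinearMap.norm_compContinuousLinearMap_le _ _).trans ?_
      refine mul_le_of_le_one_right (norm_nonneg _) ?_
      exact Finset.prod_le_one (fun _ _ => norm_nonneg _)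
        (fun _ _ => ContinuousLinearMap.norm_fst_le ..)
    have hg (i : ℕ) (z : E × F) :
        ‖iteratedFDeriv ℝ i (fun z : E × F => g z.2) z‖ ≤ ‖iteratedFDeriv ℝ i g z.2‖ := by
      have h := (ContinuousLinearMap.snd ℝ E F).iteratedFDeriv_comp_right
        (g.smooth ⊤) z (i := i) (mod_cast le_top)
      change iteratedFDeriv ℝ i (fun z : E × F => g z.2) z = _ at h
      rw [h]
      refine (ContinuousMultilinearMap.norm_compContinuousLinearMap_le _ _).trans ?_
      refine mul_le_of_le_one_right (norm_nonneg _) ?_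
      exact Finset.prod_le_one (fun _ _ => norm_nonneg _)
        (fun _ _ => ContinuousLinearMap.norm_snd_le ..)
    refine ⟨∑ i ∈ Finset.range (m + 1), (m.choose i : ℝ) *
      (C k i * D 0 (m - i) + C 0 i * D k (m - i)), fun z => ?_⟩
    have hmul := norm_iteratedFDeriv_mul_le (𝕜 := ℝ)
      ((f.smooth ⊤).comp (contDiff_fst (E := E) (F := F)))
      ((g.smooth ⊤).comp (contDiff_snd (E := E) (F := F))) z (n := m) (mod_cast le_top)
    refine (mul_le_mul_of_nonneg_left hmul (by positivity)).trans ?_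
    rw [Finset.mul_sum]
    refine Finset.sum_le_sum fun i _ => ?_
    set a := ‖iteratedFDeriv ℝ i f z.1‖
    set b := ‖iteratedFDeriv ℝ (m - i) g z.2‖
    have hz : ‖z‖ ^ k ≤ ‖z.1‖ ^ k + ‖z.2‖ ^ k := by
      rcases le_total ‖z.1‖ ‖z.2‖ with h | h
      · rw [Prod.norm_def, max_eq_right h]
        exact le_add_of_nonneg_left (by positivity)
      · rw [Prod.norm_def, max_eq_left h]
        exact le_add_of_nonneg_right (by positivity)
    have h1 := hC k i z.1
    have h2 := hC 0 i z.1
    have h3 := hD 0 (m - i) z.2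
    have h4 := hD k (m - i) z.2
    rw [pow_zero, one_mul] at h2 h3
    have hC0 := (hCpos k i).le
    have hC1 := (hCpos 0 i).le
    calc ‖z‖ ^ k * ((m.choose i : ℝ) * ‖iteratedFDeriv ℝ i (fun z : E × F => f z.1) z‖ *
            ‖iteratedFDeriv ℝ (m - i) (fun z : E × F => g z.2) z‖)
        ≤ (‖z.1‖ ^ k + ‖z.2‖ ^ k) * ((m.choose i : ℝ) * a * b) := by
          gcongr
          · exact hf i z
          · exact hg (m - i) z
      _ = (m.choose i : ℝ) * ((‖z.1‖ ^ k * a) * b + a * (‖z.2‖ ^ k * b)) := by ring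
      _ ≤ _ := by gcongr

/-- The restriction of a Schwartz function on a product to a slice `{x} × F`. -/
def schwartzSlice {E F : Type*} [NormedAddCommGroup E] [NormedSpace ℝ E]
    [NormedAddCommGroup F] [NormedSpace ℝ F] (f : 𝓢(E × F, ℂ)) (x : E) : 𝓢(F, ℂ) :=
  compCLM ℝ (g := fun y : F => (x, y))
    (by
      have h : (fun y : F => (x, y)) =
          (fun _ : F => ((x, 0) : E × F)) + ⇑(ContinuousLinearMap.inr ℝ E F) := by
        ext y <;> simp
      rw [h]
      exact (Function.HasTemperateGrowth.const _).add
        (ContinuousLinearMap.hasTemperateGrowth _))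
    ⟨1, 1, fun y => by
      have h : ‖y‖ ≤ ‖(x, y)‖ := norm_snd_le (x, y)
      rw [pow_one, one_mul]
      linarith⟩ f

/-- The pointwise complex conjugate of a Schwartz function. -/
def schwartzConj {E : Type*} [NormedAddCommGroup E] [NormedSpace ℝ E] (f : 𝓢(E, ℂ)) : 𝓢(E, ℂ) :=
  postcompCLM (𝕜 := ℝ) (Complex.conjCLE : ℂ →L[ℝ] ℂ) f

theorem schwartzSlice_apply {E F : Type*} [NormedAddCommGroup E] [NormedSpace ℝ E]
    [NormedAddCommGroup F] [NormedSpace ℝ F] (f : 𝓢(E × F, ℂ)) (x : E) (y : F) :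
    schwartzSlice f x y = f (x, y) := rfl

/-- The linear automorphism `(x, y) ↦ (a x + b y, c x + d y)` of `E × E` when `a d - b c = 1`. -/
def sl2Equiv (E : Type*) [NormedAddCommGroup E] [NormedSpace ℝ E] (a b c d : ℝ)
    (h : a * d - b * c = 1) : (E × E) ≃L[ℝ] (E × E) :=
  let p := ContinuousLinearMap.fst ℝ E E
  let q := ContinuousLinearMap.snd ℝ E E
  .equivOfInverse ((a • p + b • q).prod (c • p + d • q)) ((d • p + (-b) • q).prod ((-c) • p + a • q))
    (fun z => Prod.ext
      (by
        simp only [p, q, ContinuousLinearMap.prod_apply, _root_.add_apply, _root_.smul_apply,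
          ContinuousLinearMap.coe_fst', ContinuousLinearMap.coe_snd']
        match_scalars <;> grind)
      (by
        simp only [p, q, ContinuousLinearMap.prod_apply, _root_.add_apply, _root_.smul_apply,
          ContinuousLinearMap.coe_fst', ContinuousLinearMap.coe_snd']
        match_scalars <;> grind))
    (fun z => Prod.ext
      (by
        simp only [p, q, ContinuousLinearMap.prod_apply, _root_.add_apply, _root_.smul_apply,
          ContinuousLinearMap.coe_fst', ContinuousLinearMap.coe_snd']
        match_scalars <;> grind)
      (by
        simp only [p, q, ContinuousLinearMap.prod_apply, _root_.add_apply, _root_.smul_apply,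
          ContinuousLinearMap.coe_fst', ContinuousLinearMap.coe_snd']
        match_scalars <;> grind))

theorem measurePreserving_shear_snd {E : Type*} [NormedAddCommGroup E] [NormedSpace ℝ E]
    [MeasurableSpace E] [BorelSpace E] [SecondCountableTopology E] (μ : Measure E) [SFinite μ]
    [μ.IsAddLeftInvariant] (t : ℝ) :
    MeasurePreserving (fun z : E × E => (z.1, t • z.1 + z.2)) (μ.prod μ) (μ.prod μ) :=
  (MeasurePreserving.id μ).skew_product (g := fun x y => t • x + y)
    (by
      change Measurable fun z : E × E => t • z.1 + z.2
      fun_prop)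
    (Filter.Eventually.of_forall fun x => map_add_left_eq_self μ (t • x))

theorem measurePreserving_shear_fst {E : Type*} [NormedAddCommGroup E] [NormedSpace ℝ E]
    [MeasurableSpace E] [BorelSpace E] [SecondCountableTopology E] (μ : Measure E) [SFinite μ]
    [μ.IsAddLeftInvariant] (t : ℝ) :
    MeasurePreserving (fun z : E × E => (z.1 + t • z.2, z.2)) (μ.prod μ) (μ.prod μ) := by
  have h := (Measure.measurePreserving_swap (μ := μ) (ν := μ)).comp
    ((measurePreserving_shear_snd μ t).comp (Measure.measurePreserving_swap (μ := μ) (ν := μ)))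
  convert h using 1
  funext z
  simp [Prod.swap, add_comm]

theorem measurePreserving_sl2 {E : Type*} [NormedAddCommGroup E] [NormedSpace ℝ E]
    [MeasurableSpace E] [BorelSpace E] [SecondCountableTopology E] (μ : Measure E) [SFinite μ]
    [μ.IsAddLeftInvariant] {a b c d : ℝ} (hb : b ≠ 0) (h : a * d - b * c = 1) :
    MeasurePreserving (fun z : E × E => (a • z.1 + b • z.2, c • z.1 + d • z.2))
      (μ.prod μ) (μ.prod μ) := by
  have hm := (measurePreserving_shear_snd μ ((d - 1) / b)).comp
    ((measurePreserving_shear_fst μ b).comp (measurePreserving_shear_snd μ ((a - 1) / b)))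
  convert hm using 1
  funext z
  refine Prod.ext ?_ ?_
  · simp only [Function.comp_apply, smul_add, smul_smul, mul_div_cancel₀ _ hb]
    module
  · simp only [Function.comp_apply, smul_add, smul_smul, mul_div_cancel₀ _ hb]
    match_scalars
    · field_simp
      linear_combination -h
    · field_simp
      ring

theorem Mflow_det (θ : ℝ) :
    (Real.cos (√7 * θ) - (√7)⁻¹ * Real.sin (√7 * θ)) *
        (Real.cos (√7 * θ) + (√7)⁻¹ * Real.sin (√7 * θ)) -
      (2 * (√7)⁻¹ * Real.sin (√7 * θ)) * (-(4 * (√7)⁻¹ * Real.sin (√7 * θ))) = 1 := by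
  have h7 : (√7)⁻¹ * (√7)⁻¹ = (7 : ℝ)⁻¹ := by
    rw [← mul_inv, Real.mul_self_sqrt (by norm_num)]
  linear_combination Real.sin_sq_add_cos_sq (√7 * θ) + 7 * Real.sin (√7 * θ) ^ 2 * h7

/-- The flow map `M(θ)` as a continuous linear automorphism. -/
def MflowEquiv (n : ℕ) (θ : ℝ) : (En n × En n) ≃L[ℝ] (En n × En n) :=
  sl2Equiv (En n) _ _ _ _ (Mflow_det θ)

theorem measurePreserving_Mflow (n : ℕ) (θ : ℝ) : MeasurePreserving (Mflow n θ) := by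
  by_cases hs : Real.sin (√7 * θ) = 0
  · rcases Real.sin_eq_zero_iff_cos_eq.mp hs with hc | hc
    · have h : Mflow n θ = id := by
        funext z
        simp [Mflow, hs, hc]
      exact h ▸ MeasurePreserving.id _
    · have h : Mflow n θ = Neg.neg := by
        funext z
        refine Prod.ext ?_ ?_ <;> simp [Mflow, hs, hc]
      exact h ▸ ((Measure.measurePreserving_neg (volume : Measure (En n))).prod
        (Measure.measurePreserving_neg (volume : Measure (En n))))
  · exact measurePreserving_sl2 (volume : Measure (En n))
      (mul_ne_zero (mul_ne_zero two_ne_zero (by positivity)) hs) (Mflow_det θ)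

theorem F2_eq_fourier (n : ℕ) (Ψ : En n × En n → ℂ) (z : En n × En n) :
    F2 n Ψ z = (((2 * Real.pi) ^ (-(n : ℝ) / 2) : ℝ) : ℂ) *
      𝓕 (fun p => Ψ (z.1, p)) ((2 * Real.pi)⁻¹ • z.2) := by
  rw [F2, Real.fourier_eq']
  congr 2
  funext p
  have h : -2 * π * ⟪p, (2 * π)⁻¹ • z.2⟫_ℝ = -⟪z.2, p⟫_ℝ := by
    rw [real_inner_smul_right, real_inner_comm]
    field_simp
  rw [h, smul_eq_mul]
  push_cast
  ring_nf

theorem F2inv_eq_fourierInv (n : ℕ) (Ψ : En n × En n → ℂ) (z : En n × En n) :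
    F2inv n Ψ z = (((2 * Real.pi) ^ (-(n : ℝ) / 2) : ℝ) : ℂ) *
      𝓕⁻ (fun p => Ψ (z.1, p)) ((2 * Real.pi)⁻¹ • z.2) := by
  rw [F2inv, Real.fourierInv_eq']
  congr 2
  funext p
  have h : 2 * π * ⟪p, (2 * π)⁻¹ • z.2⟫_ℝ = ⟪p, z.2⟫_ℝ := by
    rw [real_inner_smul_right]
    field_simp
  rw [h, smul_eq_mul]
  ring_nf

theorem GK_eq_F2inv (n : ℕ) (K : En n × En n → ℂ) : GK n K = F2inv n K := by
  funext z
  simp only [GK, F2inv, real_inner_comm]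

theorem conj_FT (n : ℕ) (φ : En n → ℂ) (p : En n) :
    conj (FT n φ p) = (((2 * Real.pi) ^ (-(n : ℝ) / 2) : ℝ) : ℂ) *
      ∫ y : En n, Complex.exp (Complex.I * (⟪y, p⟫_ℝ : ℂ)) * conj (φ y) := by
  rw [FT, map_mul, Complex.conj_ofReal, ← integral_conj]
  congr 2
  funext y
  rw [map_mul, ← Complex.exp_conj, map_neg, map_mul, Complex.conj_I, Complex.conj_ofReal,
    real_inner_comm, neg_mul, neg_neg]

theorem tensor_conj_FT (n : ℕ) (ψ φ : En n → ℂ) :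
    (fun w : En n × En n => ψ w.1 * conj (FT n φ w.2)) =
      F2inv n (fun w => ψ w.1 * conj (φ w.2)) := by
  funext w
  rw [conj_FT, F2inv, mul_left_comm, ← integral_const_mul]
  congr 2
  funext y
  ring

theorem fourier_const_sq (n : ℕ) :
    ((2 * π) ^ (-(n : ℝ) / 2) * (2 * π) ^ (-(n : ℝ) / 2)) * (2 * π) ^ n = (1 : ℝ) := by
  have h : (0 : ℝ) < 2 * π := by positivity
  rw [← Real.rpow_natCast, ← Real.rpow_add h, ← Real.rpow_add h]
  ring_nf
  exact Real.rpow_zero _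

theorem integral_comp_inv_two_pi_smul (n : ℕ) (f : En n → ℂ) :
    ∫ p, f ((2 * π)⁻¹ • p) = (((2 * π) ^ n : ℝ) : ℂ) * ∫ p, f p := by
  rw [Measure.integral_comp_inv_smul_of_nonneg _ _ (by positivity), finrank_euclideanSpace_fin,
    Complex.real_smul]

theorem F2_F2inv (n : ℕ) (A : 𝓢(En n × En n, ℂ)) : F2 n (F2inv n A) = A := by
  funext z
  have h1 (p : En n) : F2inv n A (z.1, p) = (((2 * π) ^ (-(n : ℝ) / 2) : ℝ) : ℂ) *
      𝓕⁻ (schwartzSlice A z.1) ((2 * π)⁻¹ • p) := by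
    rw [F2inv_eq_fourierInv, SchwartzMap.fourierInv_coe]
    rfl
  have h2 (p : En n) : Complex.exp (-(Complex.I * (⟪z.2, p⟫_ℝ : ℂ))) * F2inv n A (z.1, p) =
      (((2 * π) ^ (-(n : ℝ) / 2) : ℝ) : ℂ) *
        (Complex.exp ((↑(-2 * π * ⟪(2 * π)⁻¹ • p, z.2⟫_ℝ) * Complex.I)) •
          𝓕⁻ (schwartzSlice A z.1) ((2 * π)⁻¹ • p)) := by
    have h : -2 * π * ⟪(2 * π)⁻¹ • p, z.2⟫_ℝ = -⟪z.2, p⟫_ℝ := by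
      rw [real_inner_smul_left, real_inner_comm]
      field_simp
    rw [h, h1, smul_eq_mul, Complex.ofReal_neg, neg_mul, mul_comm Complex.I]
    ring
  have h3 := integral_comp_inv_two_pi_smul n fun q => (((2 * π) ^ (-(n : ℝ) / 2) : ℝ) : ℂ) *
    (Complex.exp ((↑(-2 * π * ⟪q, z.2⟫_ℝ) * Complex.I)) • 𝓕⁻ (schwartzSlice A z.1) q)
  have hc : ((((2 * π) ^ (-(n : ℝ) / 2) : ℝ) : ℂ) * (((2 * π) ^ (-(n : ℝ) / 2) : ℝ) : ℂ)) *
      (((2 * π) ^ n : ℝ) : ℂ) = 1 := by exact_mod_cast fourier_const_sq n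
  rw [F2, integral_congr_ae (Filter.Eventually.of_forall h2), h3, integral_const_mul,
    ← Real.fourier_eq', ← SchwartzMap.fourier_coe, FourierTransform.fourier_fourierInv_eq,
    schwartzSlice_apply]
  linear_combination (A (z.1, z.2)) * hc

theorem integral_conj_F2inv_mul_F2inv_slice (n : ℕ) (A B : 𝓢(En n × En n, ℂ)) (x : En n) :
    ∫ p, conj (F2inv n A (x, p)) * F2inv n B (x, p) = ∫ ξ, conj (A (x, ξ)) * B (x, ξ) := by
  have h1 (A : 𝓢(En n × En n, ℂ)) (p : En n) :
      F2inv n A (x, p) = (((2 * π) ^ (-(n : ℝ) / 2) : ℝ) : ℂ) *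
        𝓕⁻ (schwartzSlice A x) ((2 * π)⁻¹ • p) := by
    rw [F2inv_eq_fourierInv, SchwartzMap.fourierInv_coe]
    rfl
  have hc : ((((2 * π) ^ (-(n : ℝ) / 2) : ℝ) : ℂ) * (((2 * π) ^ (-(n : ℝ) / 2) : ℝ) : ℂ)) *
      (((2 * π) ^ n : ℝ) : ℂ) = 1 := by exact_mod_cast fourier_const_sq n
  have h2 (p : En n) : conj (F2inv n A (x, p)) * F2inv n B (x, p) =
      ((((2 * π) ^ (-(n : ℝ) / 2) : ℝ) : ℂ) * (((2 * π) ^ (-(n : ℝ) / 2) : ℝ) : ℂ)) *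
        (conj (𝓕⁻ (schwartzSlice A x) ((2 * π)⁻¹ • p)) *
          𝓕⁻ (schwartzSlice B x) ((2 * π)⁻¹ • p)) := by
    simp only [h1, map_mul, Complex.conj_ofReal]
    ring
  have h3 := integral_inner_fourier_fourier (𝓕⁻ (schwartzSlice A x)) (𝓕⁻ (schwartzSlice B x))
  simp only [FourierTransform.fourier_fourierInv_eq, RCLike.inner_apply'] at h3
  have h4 := integral_comp_inv_two_pi_smul n fun q =>
    conj (𝓕⁻ (schwartzSlice A x) q) * 𝓕⁻ (schwartzSlice B x) q
  rw [integral_congr_ae (Filter.Eventually.of_forall h2), integral_const_mul, h4, ← mul_assoc, hc,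
    one_mul]
  exact h3.symm

instance hasTemperateGrowth_volume_prod (n : ℕ) :
    (volume : Measure (En n × En n)).HasTemperateGrowth :=
  have : (volume : Measure (En n × En n)).IsAddHaarMeasure :=
    Measure.prod.instIsAddHaarMeasure volume volume
  inferInstance

theorem stronglyMeasurable_F2inv (n : ℕ) (A : 𝓢(En n × En n, ℂ)) :
    StronglyMeasurable (F2inv n A) := by
  have h : Continuous fun w : (En n × En n) × En n =>
      Complex.exp (Complex.I * (⟪w.2, w.1.2⟫_ℝ : ℂ)) * A (w.1.1, w.2) := by
    have := A.continuous
    fun_prop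
  exact (h.stronglyMeasurable.integral_prod_right' (ν := volume)).const_mul _

theorem integral_norm_sq_F2inv_slice (n : ℕ) (A : 𝓢(En n × En n, ℂ)) (x : En n) :
    ∫ p, ‖F2inv n A (x, p)‖ ^ 2 = ∫ ξ, ‖A (x, ξ)‖ ^ 2 := by
  have h := integral_conj_F2inv_mul_F2inv_slice n A A x
  simp only [Complex.conj_mul', ← Complex.ofReal_pow, integral_complex_ofReal] at h
  exact_mod_cast h

theorem integrable_norm_sq_F2inv_slice (n : ℕ) (A : 𝓢(En n × En n, ℂ)) (x : En n) :
    Integrable fun p => ‖F2inv n A (x, p)‖ ^ 2 := by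
  have h := (((𝓕⁻ (schwartzSlice A x)).memLp 2 volume).integrable_norm_pow two_ne_zero).comp_smul
    (R := (2 * π)⁻¹) (by positivity)
  have h' := h.const_mul (‖(((2 * π) ^ (-(n : ℝ) / 2) : ℝ) : ℂ)‖ ^ 2)
  refine h'.congr (Filter.Eventually.of_forall fun p => ?_)
  simp only [F2inv_eq_fourierInv, norm_mul, mul_pow, SchwartzMap.fourierInv_coe]
  rfl

theorem memLp_two_F2inv (n : ℕ) (A : 𝓢(En n × En n, ℂ)) : MemLp (F2inv n A) 2 := by
  have hm := (stronglyMeasurable_F2inv n A).aestronglyMeasurable (μ := volume)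
  rw [memLp_two_iff_integrable_sq_norm hm, Measure.volume_eq_prod,
    integrable_prod_iff (by exact hm.norm.pow 2)]
  refine ⟨Filter.Eventually.of_forall (integrable_norm_sq_F2inv_slice n A), ?_⟩
  simp only [norm_pow, norm_norm, integral_norm_sq_F2inv_slice]
  exact ((A.memLp 2 volume).integrable_norm_pow two_ne_zero).integral_prod_left

/-- Plancherel's theorem for the partial inverse Fourier transform. -/
theorem integral_conj_F2inv_mul_F2inv (n : ℕ) (A B : 𝓢(En n × En n, ℂ)) :
    ∫ z, conj (F2inv n A z) * F2inv n B z = ∫ z, conj (A z) * B z := by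
  have h1 : Integrable fun z => conj (F2inv n A z) * F2inv n B z :=
    (memLp_two_F2inv n A).star.integrable_mul (memLp_two_F2inv n B)
  have h2 : Integrable fun z => conj (A z) * B z :=
    (A.memLp 2 volume).star.integrable_mul (B.memLp 2 volume)
  rw [Measure.volume_eq_prod] at h1 h2 ⊢
  rw [integral_prod _ h1, integral_prod _ h2]
  simp only [integral_conj_F2inv_mul_F2inv_slice]

theorem Uop_F2inv (n : ℕ) (θ : ℝ) (A : 𝓢(En n × En n, ℂ)) :
    Uop n θ (F2inv n A) =
      F2inv n (compCLMOfContinuousLinearEquiv ℝ (MflowEquiv n (-θ)) A) := by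
  rw [Uop, F2_F2inv]
  rfl

theorem integral_conj_Uop_mul_Uop (n : ℕ) (θ : ℝ) (A B : 𝓢(En n × En n, ℂ)) :
    ∫ z, conj (Uop n θ (F2inv n A) z) * Uop n θ (F2inv n B) z = ∫ z, conj (A z) * B z := by
  rw [Uop_F2inv, Uop_F2inv, integral_conj_F2inv_mul_F2inv]
  exact (measurePreserving_Mflow n (-θ)).integral_comp
    (MflowEquiv n (-θ)).toHomeomorph.measurableEmbedding (fun z => conj (A z) * B z)

/-- Fractional kernel formula:
`∫∫ K(x,y) ψ(y) conj(φ(x)) dy dx = ∫∫ conj(b^θ) W^θ(ψ,φ)`,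
where `b^θ = (2π)^{n/2} U(θ)(G K†)` and `K†(x,y) = conj(K(y,x))`. -/
theorem statement13 (n : ℕ) (θ : ℝ) (K : SchwartzMap (En n × En n) ℂ)
    (ψ φ : SchwartzMap (En n) ℂ) :
    (∫ z : En n × En n, K z * ψ z.2 * conj (φ z.1))
      = ∫ z : En n × En n,
          conj ((((2 * Real.pi) ^ ((n : ℝ) / 2) : ℝ) : ℂ) *
              Uop n θ (GK n (fun w => conj (K (w.2, w.1)))) z) *
            fWig n θ (⇑ψ) (⇑φ) z := by
  have hL : GK n (fun w => conj (K (w.2, w.1))) = F2inv n (schwartzConj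
      (compCLMOfContinuousLinearEquiv ℝ (ContinuousLinearEquiv.prodComm ℝ (En n) (En n)) K)) :=
    GK_eq_F2inv n _
  have hR : (fun w : En n × En n => ψ w.1 * conj (FT n φ w.2)) =
      F2inv n (schwartzTensor ψ (schwartzConj φ)) := tensor_conj_FT n ψ φ
  have hc : (((2 * π) ^ ((n : ℝ) / 2) : ℝ) : ℂ) * (((2 * π) ^ (-(n : ℝ) / 2) : ℝ) : ℂ) = 1 := by
    rw [← Complex.ofReal_mul, ← Real.rpow_add (by positivity), neg_div, add_neg_cancel,
      Real.rpow_zero, Complex.ofReal_one]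
  have hpt (u v : ℂ) : conj ((((2 * π) ^ ((n : ℝ) / 2) : ℝ) : ℂ) * u) *
      ((((2 * π) ^ (-(n : ℝ) / 2) : ℝ) : ℂ) * v) = conj u * v := by
    rw [map_mul, Complex.conj_ofReal]
    linear_combination conj u * v * hc
  simp only [fWig, hL, hR, hpt]
  rw [integral_conj_Uop_mul_Uop, Measure.volume_eq_prod, ← integral_prod_swap]
  refine integral_congr_ae (Filter.Eventually.of_forall fun z => ?_)
  change K (z.2, z.1) * ψ z.1 * conj (φ z.2) = conj (conj (K (z.2, z.1))) * (ψ z.1 * conj (φ z.2))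
  rw [Complex.conj_conj, mul_assoc]
end
end
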